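/- With Z(2m) = 8^m (3m-4)! / ((m-2)! (2m)!) for m ≥ 2 and Z(2) = 4/3, ρ = 12 and α = √54, and q_{2k} = q_{2k+1} = Z(2k+2) ρ^{-1} α^{-2k} for k ≥ 0, the sum over odd indices satisfies ∑_{k≥0} q_{2k+1} = 1/8. -/

import Mathlib

/-- `Z2 m` is the quantity `Z(2m)` from the paper: `Z(2) = 4/3` and
`Z(2m) = 8^m (3m-4)! / ((m-2)! (2m)!)` for `m ≥ 2`. -/
def Z2 (m : ℕ) : ℚ :=
  if m = 1 then 4/3
  else (8 : ℚ) ^ m * (Nat.factorial (3 * m - 4)) /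
    ((Nat.factorial (m - 2)) * (Nat.factorial (2 * m)))

/-- `q2 k` is `q_{2k} = q_{2k+1} = Z(2k+2) ρ^{-1} α^{-2k}` with `ρ = 12`, `α² = 54`. -/
def q2 (k : ℕ) : ℚ := Z2 (k + 1) / (12 * 54 ^ k)

open Filter Topology Finset

/-- The `m`-th term `(-1/3)ₘ (-2/3)ₘ / (m! (c)ₘ)` of the hypergeometric series
`₂F₁(-1/3, -2/3; c; 1)`. -/
noncomputable def hypTerm (c : ℝ) (m : ℕ) : ℝ :=
  ∏ i ∈ range m, ((i - 1 / 3 : ℝ) * (i - 2 / 3)) / ((i + 1) * (i + c))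

lemma hypTerm_zero (c : ℝ) : hypTerm c 0 = 1 := by simp [hypTerm]

lemma hypTerm_succ (c : ℝ) (m : ℕ) :
    hypTerm c (m + 1) =
      hypTerm c m * (((m - 1 / 3 : ℝ) * (m - 2 / 3)) / ((m + 1) * (m + c))) :=
  prod_range_succ _ _

lemma hypTerm_numerator_pos (m : ℕ) : 0 < (m - 1 / 3 : ℝ) * (m - 2 / 3) := by
  rcases m with _ | m
  · norm_num
  · push_cast
    have : (0 : ℝ) ≤ m := m.cast_nonneg
    apply mul_pos <;> linarith

lemma hypTerm_pos {c : ℝ} (hc : 0 < c) (m : ℕ) : 0 < hypTerm c m :=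
  prod_pos fun i _ => div_pos (hypTerm_numerator_pos i) (by positivity)

/-- Raising the lower parameter by one. -/
lemma hypTerm_add_one {c : ℝ} (hc : 0 < c) (m : ℕ) :
    hypTerm (c + 1) m = hypTerm c m * (c / (m + c)) := by
  induction m with
  | zero => simp [hypTerm_zero, hc.ne']
  | succ m ih =>
    rw [hypTerm_succ, hypTerm_succ, ih]
    have : (m + c : ℝ) ≠ 0 := by positivity
    have : (m + (c + 1) : ℝ) ≠ 0 := by positivity
    have : (m + 1 + c : ℝ) ≠ 0 := by positivity
    push_cast
    field_simp
    ring

lemma hypTerm_succ_le {c : ℝ} (hc : 1 / 2 ≤ c) (m : ℕ) :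
    hypTerm c (m + 1) ≤ hypTerm (1 / 2) (m + 1) * (1 / 2 / c) := by
  have hc0 : 0 < c := by linarith
  induction m with
  | zero =>
    simp only [hypTerm_succ, hypTerm_zero]
    apply le_of_eq
    push_cast
    field_simp
    ring
  | succ m ih =>
    rw [hypTerm_succ c, hypTerm_succ (1 / 2) (m + 1), mul_right_comm]
    have := hypTerm_pos (c := 1 / 2) (by norm_num) (m + 1)
    have := hypTerm_numerator_pos (m + 1)
    gcongr

lemma hypTerm_half_le (m : ℕ) : hypTerm (1 / 2) (m + 1) ≤ 2 / ((m : ℝ) + 2) ^ 2 := by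
  induction m with
  | zero => norm_num [hypTerm_succ, hypTerm_zero]
  | succ m ih =>
    rw [hypTerm_succ]
    have hn := hypTerm_numerator_pos (m + 1)
    refine (mul_le_mul_of_nonneg_right ih (by positivity)).trans ?_
    push_cast
    rw [div_mul_div_comm, div_le_div_iff₀ (by positivity) (by positivity)]
    have : (0 : ℝ) ≤ m := m.cast_nonneg
    have h : 0 ≤ (m : ℝ) ^ 2 := by positivity
    have h3 : 0 ≤ (m : ℝ) ^ 3 := by positivity
    have h4 : 0 ≤ (m : ℝ) ^ 4 := by positivity
    nlinarith

lemma hypTerm_le {c : ℝ} (hc : 1 / 2 ≤ c) (m : ℕ) :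
    hypTerm c (m + 1) ≤ 2 / ((m : ℝ) + 2) ^ 2 := by
  refine (hypTerm_succ_le hc m).trans (le_trans ?_ (hypTerm_half_le m))
  refine mul_le_of_le_one_right (hypTerm_pos (by norm_num) _).le ?_
  exact (div_le_one (by linarith)).2 hc

lemma summable_hypTerm {c : ℝ} (hc : 1 / 2 ≤ c) : Summable (hypTerm c) := by
  rw [← summable_nat_add_iff 1]
  refine Summable.of_nonneg_of_le (fun m => (hypTerm_pos (by linarith) _).le) (hypTerm_le hc) ?_
  have h := (summable_nat_add_iff 2).2 (Real.summable_one_div_nat_pow.2 (one_lt_two))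
  refine (h.mul_left 2).congr fun m => ?_
  push_cast
  ring

lemma tendsto_mul_hypTerm {c : ℝ} (hc : 1 / 2 ≤ c) :
    Tendsto (fun m : ℕ => (m : ℝ) * hypTerm c m) atTop (𝓝 0) := by
  rw [← tendsto_add_atTop_iff_nat 1]
  have h := (tendsto_one_div_add_atTop_nhds_zero_nat (𝕜 := ℝ)).const_mul 2
  rw [mul_zero] at h
  refine squeeze_zero (fun m => ?_) (fun m => ?_) h
  · have := hypTerm_pos (c := c) (by linarith) (m + 1)
    positivity
  · refine (mul_le_mul_of_nonneg_left (hypTerm_le hc m) (by positivity)).trans ?_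
    push_cast
    rw [← mul_div_assoc, ← mul_div_assoc, div_le_div_iff₀ (by positivity) (by positivity)]
    have : (0 : ℝ) ≤ m := m.cast_nonneg
    nlinarith

/-- Gauss's contiguous relation for `₂F₁(-1/3, -2/3; c; 1)`. -/
lemma tsum_hypTerm_contiguous {c : ℝ} (hc : 1 / 2 ≤ c) :
    c * (c + 1) * ∑' m, hypTerm c m =
      (c + 1 / 3) * (c + 2 / 3) * ∑' m, hypTerm (c + 1) m := by
  have hc0 : 0 < c := by linarith
  have hpartial (M : ℕ) :
      c * (c + 1) * ∑ m ∈ range M, hypTerm c m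
        - (c + 1 / 3) * (c + 2 / 3) * ∑ m ∈ range M, hypTerm (c + 1) m
        = -c * (M * hypTerm c M) := by
    induction M with
    | zero => simp
    | succ M ih =>
      rw [sum_range_succ, sum_range_succ, mul_add _ (∑ m ∈ range M, hypTerm c m),
        mul_add _ (∑ m ∈ range M, hypTerm (c + 1) m), add_sub_add_comm, ih,
        hypTerm_add_one hc0, hypTerm_succ]
      have : (M + c : ℝ) ≠ 0 := by positivity
      push_cast
      field_simp
      ring
  have h₁ := ((summable_hypTerm hc).hasSum.tendsto_sum_nat.const_mul (c * (c + 1))).sub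
    ((summable_hypTerm (c := c + 1) (by linarith)).hasSum.tendsto_sum_nat.const_mul
      ((c + 1 / 3) * (c + 2 / 3)))
  have h₂ := (tendsto_mul_hypTerm hc).const_mul (-c)
  rw [mul_zero] at h₂
  exact sub_eq_zero.1 (tendsto_nhds_unique (h₁.congr hpartial) h₂)

lemma tendsto_tsum_hypTerm :
    Tendsto (fun n : ℕ => ∑' m, hypTerm (n + 1 / 2) m) atTop (𝓝 1) := by
  have hn (n : ℕ) : (1 / 2 : ℝ) ≤ n + 1 / 2 := by
    have : (0 : ℝ) ≤ n := n.cast_nonneg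
    linarith
  set S := ∑' m, hypTerm (1 / 2) (m + 1)
  have hS : 0 ≤ S := tsum_nonneg fun m => (hypTerm_pos (by norm_num) _).le
  have hsplit (n : ℕ) : ∑' m, hypTerm (n + 1 / 2) m = 1 + ∑' m, hypTerm (n + 1 / 2) (m + 1) := by
    rw [(summable_hypTerm (hn n)).tsum_eq_zero_add, hypTerm_zero]
  have htail : Tendsto (fun n : ℕ => ∑' m, hypTerm (n + 1 / 2) (m + 1)) atTop (𝓝 0) := by
    have h := (tendsto_one_div_add_atTop_nhds_zero_nat (𝕜 := ℝ)).const_mul S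
    rw [mul_zero] at h
    refine squeeze_zero
      (fun n => tsum_nonneg fun m => (hypTerm_pos (by positivity) _).le) (fun n => ?_) h
    have hs := (summable_nat_add_iff 1).2 (summable_hypTerm (le_refl (1 / 2 : ℝ)))
    have hs' := (summable_nat_add_iff 1).2 (summable_hypTerm (hn n))
    refine (hs'.tsum_le_tsum (fun m => hypTerm_succ_le (hn n) m) (hs.mul_right _)).trans ?_
    rw [tsum_mul_right]
    refine mul_le_mul_of_nonneg_left ?_ hS
    rw [div_le_div_iff₀ (by positivity) (by positivity)]
    have : (0 : ℝ) ≤ n := n.cast_nonneg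
    linarith
  simpa only [hsplit, add_zero] using htail.const_add 1

lemma tsum_hypTerm_half : ∑' m, hypTerm (1 / 2) m = 3 / 2 := by
  have hiter (n : ℕ) :
      (∏ j ∈ range n, (1 - (1 / 2 : ℝ) ^ 2 / ((j : ℝ) + 1) ^ 2)) * ∑' m, hypTerm (1 / 2) m =
        (∏ j ∈ range n, (1 - (1 / 6 : ℝ) ^ 2 / ((j : ℝ) + 1) ^ 2)) *
          ∑' m, hypTerm (n + 1 / 2) m := by
    induction n with
    | zero => simp
    | succ n ih =>
      have h := tsum_hypTerm_contiguous (c := n + 1 / 2)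
        (by have : (0 : ℝ) ≤ n := n.cast_nonneg
            linarith)
      rw [prod_range_succ, prod_range_succ, mul_right_comm, ih, Nat.cast_succ,
        add_right_comm (n : ℝ) 1, mul_right_comm, mul_assoc, mul_assoc]
      congr 1
      generalize ∑' m, hypTerm (n + 1 / 2) m = x at h ⊢
      generalize ∑' m, hypTerm (n + 1 / 2 + 1) m = y at h ⊢
      field_simp
      linear_combination 144 * h
  have h₂ := (Real.tendsto_euler_sin_prod (1 / 2)).mul_const (∑' m, hypTerm (1 / 2) m)
  have h₆ := (Real.tendsto_euler_sin_prod (1 / 6)).mul tendsto_tsum_hypTerm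
  have h := tendsto_nhds_unique h₂ ((h₆.const_mul 3).congr fun n => by
    linear_combination -(Real.pi / 2) * hiter n)
  rw [mul_one_div, mul_one_div, Real.sin_pi_div_two, Real.sin_pi_div_six] at h
  linarith

lemma Z2_add_three (k : ℕ) :
    Z2 (k + 3) = Z2 (k + 2) *
      (8 * (3 * k + 5) * (3 * k + 4) * 3 / ((2 * k + 6) * (2 * k + 5))) := by
  have h₁ : 3 * (k + 3) - 4 = 3 * k + 2 + 1 + 1 + 1 := by omega
  have h₂ : 3 * (k + 2) - 4 = 3 * k + 2 := by omega
  have h₃ : 2 * (k + 3) = 2 * (k + 2) + 1 + 1 := by omega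
  have h₄ : k + 3 - 2 = k + 1 := by omega
  have h₅ : k + 2 - 2 = k := by omega
  simp only [Z2, if_neg (show k + 3 ≠ 1 by omega), if_neg (show k + 2 ≠ 1 by omega),
    h₁, h₂, h₃, h₄, h₅, Nat.factorial_succ]
  have := Nat.factorial_ne_zero k
  have := Nat.factorial_ne_zero (2 * (k + 2))
  push_cast
  field_simp
  ring

lemma q2_eq_hypTerm (k : ℕ) : (q2 k : ℝ) = hypTerm (1 / 2) (k + 1) / 4 := by
  induction k with
  | zero => norm_num [q2, Z2, hypTerm_succ, hypTerm_zero]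
  | succ k ih =>
    rcases k with _ | k
    · norm_num [q2, Z2, hypTerm_succ, hypTerm_zero, Nat.factorial]
    · have hq : q2 (k + 2) = q2 (k + 1) *
          (8 * (3 * k + 5) * (3 * k + 4) * 3 / ((2 * k + 6) * (2 * k + 5)) / 54) := by
        simp only [q2, Z2_add_three, pow_succ]
        field_simp
      rw [hq, Rat.cast_mul, ih, hypTerm_succ _ (k + 2)]
      push_cast
      field_simp
      ring

/-- The sum of the peeling probabilities over odd indices:
`∑_{k≥0} q_{2k+1} = 1/8`. -/
theorem sum_q_odd : ∑' k : ℕ, ((q2 k : ℝ)) = 1 / 8 := by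
  have h := (summable_hypTerm (le_refl (1 / 2 : ℝ))).tsum_eq_zero_add
  rw [hypTerm_zero, tsum_hypTerm_half] at h
  simp only [q2_eq_hypTerm, tsum_div_const]
  linarith
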